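/- For every x ∈ ℝ^n, the second moment of the zeroth-order gradient oracle satisfies E_u‖ ((h(x + μu) − h(x))/μ) · u ‖² ≤ 4(n + 4) ‖∇h_μ(x)‖² + (3/2) μ² L² (n + 5)³. -/

import Mathlib

open MeasureTheory ProbabilityTheory Real

noncomputable section

/-- `Vec n` is the Euclidean space `ℝ^n`. -/
abbrev Vec (n : ℕ) := EuclideanSpace ℝ (Fin n)

/-- The standard Gaussian measure on `ℝ^n` (mean zero, identity covariance). -/
def stdGaussian (n : ℕ) : Measure (Vec n) :=
  (Measure.pi fun _ : Fin n => gaussianReal 0 1).map (EuclideanSpace.equiv (Fin n) ℝ).symm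

/-- Gaussian smooth approximation `h_μ(x) = E_u[h(x + μ u)]`. -/
def smooth {n : ℕ} (h : Vec n → ℝ) (μ : ℝ) (x : Vec n) : ℝ :=
  ∫ u, h (x + μ • u) ∂(stdGaussian n)

open scoped RealInnerProductSpace

theorem iteratedDeriv_four_and_six_exp_mul_sq (v : ℝ) :
    iteratedDeriv 4 (fun t => exp (v * t ^ 2 / 2)) 0 = 3 * v ^ 2 ∧
      iteratedDeriv 6 (fun t => exp (v * t ^ 2 / 2)) 0 = 15 * v ^ 3 := by
  have deriv_mul_exp (p p' : ℝ → ℝ) (hp : ∀ t, HasDerivAt p (p' t) t) :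
      deriv (fun t => p t * exp (v * t ^ 2 / 2)) =
        fun t => (p' t + v * t * p t) * exp (v * t ^ 2 / 2) := by
    funext t
    have hexp : HasDerivAt (fun t => exp (v * t ^ 2 / 2)) (exp (v * t ^ 2 / 2) * (v * t)) t := by
      convert! (((hasDerivAt_pow 2 t).const_mul v).div_const 2).exp using 1
      push_cast; ring
    refine ((hp t).mul hexp).deriv.trans ?_
    ring
  have h0 : (fun t => exp (v * t ^ 2 / 2)) =
      fun t => (fun _ : ℝ => (1 : ℝ)) t * exp (v * t ^ 2 / 2) := by
    simp
  have hpow (c : ℝ) (k : ℕ) (t : ℝ) :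
      HasDerivAt (fun t : ℝ => c * t ^ k) (c * (k * t ^ (k - 1))) t :=
    (hasDerivAt_pow k t).const_mul c
  have h1 := deriv_mul_exp _ _ fun t => hasDerivAt_const t (1 : ℝ)
  have h2 := deriv_mul_exp (fun t => 0 + v * t * 1) (fun t => v) fun t => by
    simpa using (hasDerivAt_id t).const_mul v
  have h3 := deriv_mul_exp (fun t => v + v * t * (0 + v * t * 1)) (fun t => 2 * v ^ 2 * t) fun t => by
    convert! (hpow (v ^ 2) 2 t).const_add v using 1
    · funext t; ring
    · push_cast; ring
  have h4 := deriv_mul_exp (fun t => 2 * v ^ 2 * t + v * t * (v + v * t * (0 + v * t * 1)))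
      (fun t => 3 * v ^ 2 + 3 * v ^ 3 * t ^ 2) fun t => by
    convert! (hpow (3 * v ^ 2) 1 t).add (hpow (v ^ 3) 3 t) using 1
    · funext t; simp; ring
    · push_cast; ring
  have h5 := deriv_mul_exp (fun t => 3 * v ^ 2 + 3 * v ^ 3 * t ^ 2 +
      v * t * (2 * v ^ 2 * t + v * t * (v + v * t * (0 + v * t * 1))))
      (fun t => 12 * v ^ 3 * t + 4 * v ^ 4 * t ^ 3) fun t => by
    convert! ((hpow (6 * v ^ 3) 2 t).add (hpow (v ^ 4) 4 t)).const_add (3 * v ^ 2) using 1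
    · funext t; simp; ring
    · push_cast; ring
  have h6 := deriv_mul_exp (fun t => 12 * v ^ 3 * t + 4 * v ^ 4 * t ^ 3 +
      v * t * (3 * v ^ 2 + 3 * v ^ 3 * t ^ 2 +
        v * t * (2 * v ^ 2 * t + v * t * (v + v * t * (0 + v * t * 1)))))
      (fun t => 15 * v ^ 3 + 30 * v ^ 4 * t ^ 2 + 5 * v ^ 5 * t ^ 4) fun t => by
    convert! ((hpow (15 * v ^ 3) 1 t).add (hpow (10 * v ^ 4) 3 t)).add (hpow (v ^ 5) 5 t) using 1
    · funext t; simp; ring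
    · push_cast; ring
  rw [h0]
  constructor
  · simp only [iteratedDeriv_succ, iteratedDeriv_zero, h1, h2, h3, h4]
    simp
  · simp only [iteratedDeriv_succ, iteratedDeriv_zero, h1, h2, h3, h4, h5, h6]
    simp

theorem integral_pow_gaussianReal_eq_iteratedDeriv (v : NNReal) (k : ℕ) :
    ∫ x, x ^ k ∂gaussianReal 0 v = iteratedDeriv k (fun t => exp (v * t ^ 2 / 2)) 0 := by
  have h := iteratedDeriv_mgf_zero (X := fun x => x) (μ := gaussianReal 0 v) (by simp) k
  rw [mgf_fun_id_gaussianReal] at h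
  simpa using h.symm

section Moments

variable {E : Type*} [NormedAddCommGroup E] [InnerProductSpace ℝ E] [FiniteDimensional ℝ E]

theorem norm_sq_eq_sum_inner_sq (u : E) :
    ‖u‖ ^ 2 = ∑ i, ⟪stdOrthonormalBasis ℝ E i, u⟫ ^ 2 := by
  simpa using ((stdOrthonormalBasis ℝ E).sum_sq_norm_inner_right u).symm

variable [MeasurableSpace E] [BorelSpace E]

theorem map_inner_stdGaussian (z : E) :
    (ProbabilityTheory.stdGaussian E).map (fun u => ⟪z, u⟫) = gaussianReal 0 (‖z‖₊ ^ 2) := by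
  have h := IsGaussian.map_eq_gaussianReal (μ := ProbabilityTheory.stdGaussian E) (innerSL ℝ z)
  rw [integral_strongDual_stdGaussian, variance_dual_stdGaussian, innerSL_apply_norm] at h
  rw [Real.toNNReal_pow (norm_nonneg z), norm_toNNReal] at h
  exact h

theorem integral_inner_pow_stdGaussian (z : E) (k : ℕ) :
    ∫ u, ⟪z, u⟫ ^ k ∂(ProbabilityTheory.stdGaussian E) =
      iteratedDeriv k (fun t => exp (‖z‖ ^ 2 * t ^ 2 / 2)) 0 := by
  have h := integral_pow_gaussianReal_eq_iteratedDeriv (‖z‖₊ ^ 2) k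
  rw [← map_inner_stdGaussian, integral_map (by fun_prop) (by fun_prop)] at h
  simpa using h

theorem integrable_norm_pow_stdGaussian (k : ℕ) :
    Integrable (fun u : E => ‖u‖ ^ k) (ProbabilityTheory.stdGaussian E) := by
  simpa using (IsGaussian.memLp_id (ProbabilityTheory.stdGaussian E) k (by simp)).integrable_norm_pow'

theorem integrable_inner_pow_stdGaussian (z : E) (k : ℕ) :
    Integrable (fun u => ⟪z, u⟫ ^ k) (ProbabilityTheory.stdGaussian E) := by
  refine ((integrable_norm_pow_stdGaussian k).const_mul (‖z‖ ^ k)).mono' (by fun_prop) ?_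
  filter_upwards with u
  rw [norm_pow, ← mul_pow]
  gcongr
  exact norm_inner_le_norm z u

theorem integral_sum_inner_pow_stdGaussian {ι : Type*} [Fintype ι] (c : ι → ℝ) (z : ι → E)
    (k : ℕ) : ∫ u, ∑ i, c i * ⟪z i, u⟫ ^ k ∂(ProbabilityTheory.stdGaussian E) =
      ∑ i, c i * iteratedDeriv k (fun t => exp (‖z i‖ ^ 2 * t ^ 2 / 2)) 0 := by
  rw [integral_finsetSum _ fun i _ => (integrable_inner_pow_stdGaussian (z i) k).const_mul (c i)]
  simp [integral_const_mul, integral_inner_pow_stdGaussian]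

theorem integral_inner_sq_mul_inner_sq_stdGaussian (a b : E) :
    ∫ u, ⟪a, u⟫ ^ 2 * ⟪b, u⟫ ^ 2 ∂(ProbabilityTheory.stdGaussian E) =
      ‖a‖ ^ 2 * ‖b‖ ^ 2 + 2 * ⟪a, b⟫ ^ 2 := by
  have h := integral_sum_inner_pow_stdGaussian ![1 / 12, 1 / 12, -1 / 6, -1 / 6]
    ![a + b, a - b, a, b] 4
  simp only [(iteratedDeriv_four_and_six_exp_mul_sq _).1, Fin.sum_univ_succ] at h
  simp [inner_add_left, inner_sub_left, norm_add_sq_real, norm_sub_sq_real] at h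
  convert! h using 1
  · congr 1; funext u; ring
  · ring

theorem integral_inner_sq_mul_inner_sq_mul_inner_sq_stdGaussian (a b c : E) :
    ∫ u, ⟪a, u⟫ ^ 2 * ⟪b, u⟫ ^ 2 * ⟪c, u⟫ ^ 2 ∂(ProbabilityTheory.stdGaussian E) =
      ‖a‖ ^ 2 * ‖b‖ ^ 2 * ‖c‖ ^ 2 + 2 * (⟪a, b⟫ ^ 2 * ‖c‖ ^ 2 + ⟪a, c⟫ ^ 2 * ‖b‖ ^ 2 +
        ⟪b, c⟫ ^ 2 * ‖a‖ ^ 2) + 8 * (⟪a, b⟫ * ⟪b, c⟫ * ⟪a, c⟫) := by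
  have h := integral_sum_inner_pow_stdGaussian
    ![1 / 360, 1 / 360, 1 / 360, 1 / 360, -1 / 180, -1 / 180, -1 / 180, -1 / 180, -1 / 180,
      -1 / 180, 1 / 90, 1 / 90, 1 / 90]
    ![a + b + c, a + b - c, a - b + c, a - b - c, a + b, a - b, a + c, a - c, b + c, b - c,
      a, b, c] 6
  simp only [(iteratedDeriv_four_and_six_exp_mul_sq _).2, Fin.sum_univ_succ] at h
  simp [inner_add_left, inner_sub_left, norm_add_sq_real, norm_sub_sq_real] at h
  convert! h using 1
  · congr 1; funext u; ring
  · ring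

theorem integrable_inner_sq_mul_norm_sq_stdGaussian (v : E) :
    Integrable (fun u => ⟪v, u⟫ ^ 2 * ‖u‖ ^ 2) (ProbabilityTheory.stdGaussian E) := by
  refine ((integrable_norm_pow_stdGaussian 4).const_mul (‖v‖ ^ 2)).mono' (by fun_prop) ?_
  filter_upwards with u
  rw [norm_mul, norm_pow, norm_pow, norm_norm]
  calc ‖⟪v, u⟫‖ ^ 2 * ‖u‖ ^ 2 ≤ (‖v‖ * ‖u‖) ^ 2 * ‖u‖ ^ 2 := by
        gcongr; exact norm_inner_le_norm v u
    _ = _ := by ring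

theorem integral_norm_sq_stdGaussian :
    ∫ u, ‖u‖ ^ 2 ∂(ProbabilityTheory.stdGaussian E) = Module.finrank ℝ E := by
  simp only [norm_sq_eq_sum_inner_sq]
  rw [integral_finsetSum _ fun i _ => integrable_inner_pow_stdGaussian _ 2]
  have h (z : E) : ∫ u, ⟪z, u⟫ ^ 2 ∂(ProbabilityTheory.stdGaussian E) = ‖z‖ ^ 2 := by
    have := variance_dual_stdGaussian (innerSL ℝ z)
    rw [variance_eq_integral (by fun_prop), integral_strongDual_stdGaussian] at this
    simpa using this
  simp [h]

theorem integral_inner_sq_mul_norm_sq_stdGaussian (v : E) :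
    ∫ u, ⟪v, u⟫ ^ 2 * ‖u‖ ^ 2 ∂(ProbabilityTheory.stdGaussian E) =
      (Module.finrank ℝ E + 2) * ‖v‖ ^ 2 := by
  have hint (i) : Integrable (fun u => ⟪v, u⟫ ^ 2 * ⟪stdOrthonormalBasis ℝ E i, u⟫ ^ 2)
      (ProbabilityTheory.stdGaussian E) := by
    refine (integrable_inner_sq_mul_norm_sq_stdGaussian v).mono' (by fun_prop) ?_
    filter_upwards with u
    rw [norm_of_nonneg (by positivity), norm_sq_eq_sum_inner_sq u]
    gcongr
    exact Finset.single_le_sum (f := fun i => ⟪stdOrthonormalBasis ℝ E i, u⟫ ^ 2)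
      (fun _ _ => sq_nonneg _) (Finset.mem_univ i)
  calc ∫ u, ⟪v, u⟫ ^ 2 * ‖u‖ ^ 2 ∂(ProbabilityTheory.stdGaussian E)
      = ∑ i, ∫ u, ⟪v, u⟫ ^ 2 * ⟪stdOrthonormalBasis ℝ E i, u⟫ ^ 2
          ∂(ProbabilityTheory.stdGaussian E) := by
        rw [← integral_finsetSum _ fun i _ => hint i]
        simp only [norm_sq_eq_sum_inner_sq, Finset.mul_sum]
    _ = ∑ i, (‖v‖ ^ 2 + 2 * ⟪stdOrthonormalBasis ℝ E i, v⟫ ^ 2) := by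
        simp [integral_inner_sq_mul_inner_sq_stdGaussian, real_inner_comm v]
    _ = _ := by
        rw [Finset.sum_add_distrib, ← Finset.mul_sum, ← norm_sq_eq_sum_inner_sq v]
        simp; ring

theorem integral_norm_pow_six_stdGaussian :
    ∫ u, ‖u‖ ^ 6 ∂(ProbabilityTheory.stdGaussian E) =
      (Module.finrank ℝ E : ℝ) * (Module.finrank ℝ E + 2) * (Module.finrank ℝ E + 4) := by
  set b := stdOrthonormalBasis ℝ E
  have hint (i j k) : Integrable (fun u => ⟪b i, u⟫ ^ 2 * ⟪b j, u⟫ ^ 2 * ⟪b k, u⟫ ^ 2)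
      (ProbabilityTheory.stdGaussian E) := by
    refine (integrable_norm_pow_stdGaussian 6).mono' (by fun_prop) ?_
    filter_upwards with u
    have h (i) : ⟪b i, u⟫ ^ 2 ≤ ‖u‖ ^ 2 := by
      rw [norm_sq_eq_sum_inner_sq u]
      exact Finset.single_le_sum (f := fun i => ⟪b i, u⟫ ^ 2)
        (fun _ _ => sq_nonneg _) (Finset.mem_univ i)
    rw [norm_of_nonneg (by positivity)]
    calc ⟪b i, u⟫ ^ 2 * ⟪b j, u⟫ ^ 2 * ⟪b k, u⟫ ^ 2 ≤ ‖u‖ ^ 2 * ‖u‖ ^ 2 * ‖u‖ ^ 2 := by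
          exact mul_le_mul (mul_le_mul (h i) (h j) (sq_nonneg _) (sq_nonneg _)) (h k)
            (sq_nonneg _) (by positivity)
      _ = ‖u‖ ^ 6 := by ring
  calc ∫ u, ‖u‖ ^ 6 ∂(ProbabilityTheory.stdGaussian E)
      = ∫ u, ∑ i, ∑ j, ∑ k, ⟪b i, u⟫ ^ 2 * ⟪b j, u⟫ ^ 2 * ⟪b k, u⟫ ^ 2
          ∂(ProbabilityTheory.stdGaussian E) := by
        congr 1; funext u
        simp only [← Finset.mul_sum, ← Finset.sum_mul, b, ← norm_sq_eq_sum_inner_sq]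
        ring
    _ = ∑ i, ∑ j, ∑ k, ∫ u, ⟪b i, u⟫ ^ 2 * ⟪b j, u⟫ ^ 2 * ⟪b k, u⟫ ^ 2
          ∂(ProbabilityTheory.stdGaussian E) := by
        rw [integral_finsetSum _ fun i _ => integrable_finsetSum _ fun j _ =>
          integrable_finsetSum _ fun k _ => hint i j k]
        refine Finset.sum_congr rfl fun i _ => ?_
        rw [integral_finsetSum _ fun j _ => integrable_finsetSum _ fun k _ => hint i j k]
        refine Finset.sum_congr rfl fun j _ => ?_
        rw [integral_finsetSum _ fun k _ => hint i j k]
    _ = _ := by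
        simp only [integral_inner_sq_mul_inner_sq_mul_inner_sq_stdGaussian,
          b.inner_eq_ite, b.norm_eq_one]
        simp [Finset.sum_add_distrib, ← Finset.mul_sum]
        ring

end Moments

section Oracle

variable {E : Type*} [NormedAddCommGroup E] [InnerProductSpace ℝ E]

section Complete

variable [CompleteSpace E] {h : E → ℝ} {L : NNReal}

/-- Mean value form of the first-order Taylor bound for a function with Lipschitz gradient. -/
theorem abs_sub_sub_inner_gradient_le (hd : Differentiable ℝ h)
    (hL : LipschitzWith L (gradient h)) (x w : E) :
    |h (x + w) - h x - ⟪gradient h x, w⟫| ≤ L * ‖w‖ ^ 2 := by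
  have hb : ∀ y ∈ Metric.closedBall x ‖w‖,
      ‖fderiv ℝ h y - innerSL ℝ (gradient h x)‖ ≤ L * ‖w‖ := by
    intro y hy
    have hy' : fderiv ℝ h y = innerSL ℝ (gradient h y) :=
      (hd y).hasGradientAt.hasFDerivAt.fderiv
    rw [hy', ← map_sub, innerSL_apply_norm]
    refine (hL.norm_sub_le y x).trans ?_
    gcongr
    simpa [dist_eq_norm] using hy
  have h := (convex_closedBall x ‖w‖).norm_image_sub_le_of_norm_fderiv_le'
    (fun y _ => hd y) hb (x := x) (y := x + w) (by simp) (by simp)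
  simpa [sq, mul_assoc] using h

theorem norm_gradient_add_smul_le (hL : LipschitzWith L (gradient h)) (x y u : E) {μ : ℝ}
    (hμ : 0 < μ) : ‖gradient h (y + μ • u)‖ ≤ ‖gradient h x‖ + L * (‖y - x‖ + μ * ‖u‖) := by
  have h1 := hL.norm_sub_le (y + μ • u) x
  have h2 : ‖y + μ • u - x‖ ≤ ‖y - x‖ + μ * ‖u‖ := by
    rw [add_sub_right_comm]
    refine (norm_add_le _ _).trans_eq ?_
    rw [norm_smul, norm_of_nonneg hμ.le]
  have h3 := norm_le_norm_add_norm_sub' (gradient h (y + μ • u)) (gradient h x)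
  have h4 := mul_le_mul_of_nonneg_left h2 L.coe_nonneg
  linarith

theorem norm_diff_quotient_smul_sq_le (hd : Differentiable ℝ h)
    (hL : LipschitzWith L (gradient h)) (x g u : E) {μ : ℝ} (hμ : 0 < μ) :
    ‖((h (x + μ • u) - h x) / μ) • u‖ ^ 2 ≤ 4 * (⟪g, u⟫ ^ 2 * ‖u‖ ^ 2) +
      12 * (⟪gradient h x - g, u⟫ ^ 2 * ‖u‖ ^ 2) + 3 / 2 * (L ^ 2 * μ ^ 2) * ‖u‖ ^ 6 := by
  set q := (h (x + μ • u) - h x) / μ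
  set r := q - ⟪gradient h x, u⟫
  have hr : |r| ≤ L * μ * ‖u‖ ^ 2 := by
    have h1 := abs_sub_sub_inner_gradient_le hd hL x (μ • u)
    have h2 : h (x + μ • u) - h x - ⟪gradient h x, μ • u⟫ = μ * r := by
      simp only [r, q, inner_smul_right]
      field_simp
    rw [h2, abs_mul, abs_of_pos hμ, norm_smul, norm_of_nonneg hμ.le] at h1
    refine le_of_mul_le_mul_left ?_ hμ
    linarith
  have hr2 : r ^ 2 ≤ (L * μ * ‖u‖ ^ 2) ^ 2 := sq_le_sq' (abs_le.1 hr).1 (abs_le.1 hr).2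
  have hq : q = ⟪g, u⟫ + ⟪gradient h x - g, u⟫ + r := by
    simp only [r, inner_sub_left]; ring
  generalize ⟪gradient h x - g, u⟫ = d at *
  generalize ⟪g, u⟫ = s at *
  have hq2 : q ^ 2 ≤ 4 * s ^ 2 + 12 * d ^ 2 + 3 / 2 * (L * μ * ‖u‖ ^ 2) ^ 2 := by
    rw [hq]
    nlinarith [sq_nonneg (s - 3 * d), sq_nonneg (8 * d - r), sq_nonneg (8 * s - 3 * r)]
  rw [norm_smul, mul_pow, norm_eq_abs, sq_abs]
  calc q ^ 2 * ‖u‖ ^ 2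
      ≤ (4 * s ^ 2 + 12 * d ^ 2 + 3 / 2 * (L * μ * ‖u‖ ^ 2) ^ 2) * ‖u‖ ^ 2 := by gcongr
    _ = _ := by ring

end Complete

variable [FiniteDimensional ℝ E] [MeasurableSpace E] [BorelSpace E] {h : E → ℝ} {L : NNReal}

theorem integrable_gradient_add_smul (hL : LipschitzWith L (gradient h)) (x : E) {μ : ℝ}
    (hμ : 0 < μ) :
    Integrable (fun u => gradient h (x + μ • u)) (ProbabilityTheory.stdGaussian E) := by
  have hc : Continuous fun u => gradient h (x + μ • u) := hL.continuous.comp (by fun_prop)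
  have hn : Integrable (fun u : E => ‖u‖) (ProbabilityTheory.stdGaussian E) := by
    simpa using integrable_norm_pow_stdGaussian (E := E) 1
  refine ((integrable_const ‖gradient h x‖).add
    (((integrable_const ‖x - x‖).add (hn.const_mul μ)).const_mul (L : ℝ))).mono'
      hc.aestronglyMeasurable ?_
  filter_upwards with u using norm_gradient_add_smul_le hL x x u hμ

theorem hasGradientAt_integral_stdGaussian (hd : Differentiable ℝ h)
    (hL : LipschitzWith L (gradient h)) (x : E) {μ : ℝ} (hμ : 0 < μ) :
    HasGradientAt (fun y => ∫ u, h (y + μ • u) ∂(ProbabilityTheory.stdGaussian E))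
      (∫ u, gradient h (x + μ • u) ∂(ProbabilityTheory.stdGaussian E)) x := by
  have hn : Integrable (fun u : E => ‖u‖) (ProbabilityTheory.stdGaussian E) := by
    simpa using integrable_norm_pow_stdGaussian (E := E) 1
  have hc (y : E) : Continuous fun u => h (y + μ • u) := hd.continuous.comp (by fun_prop)
  have hgc : Continuous fun u => gradient h (x + μ • u) := hL.continuous.comp (by fun_prop)
  have hint : Integrable (fun u => h (x + μ • u)) (ProbabilityTheory.stdGaussian E) := by
    refine (((integrable_const |h x|).add (hn.const_mul (‖gradient h x‖ * μ))).add
      ((integrable_norm_pow_stdGaussian 2).const_mul (L * μ ^ 2))).mono'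
      (hc x).aestronglyMeasurable ?_
    filter_upwards with u
    have h1 := abs_sub_sub_inner_gradient_le hd hL x (μ • u)
    have h2 := abs_real_inner_le_norm (gradient h x) (μ • u)
    rw [norm_smul, norm_of_nonneg hμ.le] at h1 h2
    have h3 := abs_add_three (h (x + μ • u) - h x - ⟪gradient h x, μ • u⟫) (h x)
      ⟪gradient h x, μ • u⟫
    rw [show h (x + μ • u) - h x - ⟪gradient h x, μ • u⟫ + h x + ⟪gradient h x, μ • u⟫
      = h (x + μ • u) by ring] at h3
    simp only [Pi.add_apply, norm_eq_abs]
    linarith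
  rw [hasGradientAt_iff_hasFDerivAt]
  have hcomm := (InnerProductSpace.toDual ℝ E).toContinuousLinearEquiv.integral_comp_comm
    (μ := ProbabilityTheory.stdGaussian E) fun u => gradient h (x + μ • u)
  simp only [LinearIsometryEquiv.coe_toContinuousLinearEquiv] at hcomm
  rw [← hcomm]
  refine hasFDerivAt_integral_of_dominated_of_fderiv_le
    (F' := fun y u => InnerProductSpace.toDual ℝ E (gradient h (y + μ • u)))
    (bound := fun u => ‖gradient h x‖ + L * (1 + μ * ‖u‖))
    (Metric.ball_mem_nhds x one_pos)
    (.of_forall fun y => (hc y).aestronglyMeasurable) hint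
    ((InnerProductSpace.toDual ℝ E).continuous.comp hgc).aestronglyMeasurable ?_
    ((integrable_const _).add (((integrable_const _).add (hn.const_mul μ)).const_mul (L : ℝ))) ?_
  · filter_upwards with u y hy
    rw [LinearIsometryEquiv.norm_map]
    refine (norm_gradient_add_smul_le hL x y u hμ).trans ?_
    have : ‖y - x‖ ≤ 1 := by simpa [dist_eq_norm] using (Metric.mem_ball.1 hy).le
    gcongr
  · filter_upwards with u y _
    exact (hasFDerivAt_comp_add_right (μ • u)).2 (hd (y + μ • u)).hasGradientAt.hasFDerivAt

theorem norm_gradient_sub_integral_sq_le (hL : LipschitzWith L (gradient h)) (x : E) {μ : ℝ}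
    (hμ : 0 < μ) :
    ‖gradient h x - ∫ u, gradient h (x + μ • u) ∂(ProbabilityTheory.stdGaussian E)‖ ^ 2 ≤
      L ^ 2 * μ ^ 2 * Module.finrank ℝ E := by
  have hn : Integrable (fun u : E => ‖u‖) (ProbabilityTheory.stdGaussian E) := by
    simpa using integrable_norm_pow_stdGaussian (E := E) 1
  have h1 : ‖gradient h x - ∫ u, gradient h (x + μ • u) ∂(ProbabilityTheory.stdGaussian E)‖ ≤
      L * μ * ∫ u, ‖u‖ ∂(ProbabilityTheory.stdGaussian E) := by
    have : gradient h x - ∫ u, gradient h (x + μ • u) ∂(ProbabilityTheory.stdGaussian E) =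
        ∫ u, (gradient h x - gradient h (x + μ • u)) ∂(ProbabilityTheory.stdGaussian E) := by
      rw [integral_sub (integrable_const _) (integrable_gradient_add_smul hL x hμ)]
      simp
    rw [this, ← integral_const_mul]
    refine norm_integral_le_of_norm_le (hn.const_mul _) ?_
    filter_upwards with u
    refine (hL.norm_sub_le _ _).trans_eq ?_
    rw [sub_add_cancel_left, norm_neg, norm_smul, norm_of_nonneg hμ.le, mul_assoc]
  have h2 : (∫ u, ‖u‖ ∂(ProbabilityTheory.stdGaussian E)) ^ 2 ≤ Module.finrank ℝ E := by
    rw [← integral_norm_sq_stdGaussian (E := E)]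
    exact (even_two.convexOn_pow (𝕜 := ℝ)).map_integral_le (by fun_prop) isClosed_univ
      (by simp) hn (integrable_norm_pow_stdGaussian 2)
  calc _ ≤ (L * μ * ∫ u, ‖u‖ ∂(ProbabilityTheory.stdGaussian E)) ^ 2 := by gcongr
    _ = L ^ 2 * μ ^ 2 * (∫ u, ‖u‖ ∂(ProbabilityTheory.stdGaussian E)) ^ 2 := by ring
    _ ≤ _ := by gcongr

end Oracle

theorem stdGaussian_eq (n : ℕ) : _root_.stdGaussian n = ProbabilityTheory.stdGaussian (Vec n) := by
  rw [← map_pi_eq_stdGaussian]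
  rfl

theorem statement16 {n : ℕ} (h : Vec n → ℝ) (hd : Differentiable ℝ h)
    (L : NNReal) (hL : LipschitzWith L (gradient h)) (μ : ℝ) (hμ : 0 < μ) :
    ∀ x : Vec n,
      (∫ u, ‖((h (x + μ • u) - h x) / μ) • u‖ ^ 2 ∂(stdGaussian n)) ≤
        4 * ((n : ℝ) + 4) * ‖gradient (smooth h μ) x‖ ^ 2 +
          3 / 2 * μ ^ 2 * (L : ℝ) ^ 2 * ((n : ℝ) + 5) ^ 3 := by
  intro x
  have hg : gradient (smooth h μ) x =
      ∫ u, gradient h (x + μ • u) ∂(ProbabilityTheory.stdGaussian (Vec n)) := by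
    have := (hasGradientAt_integral_stdGaussian hd hL x hμ).gradient
    rw [← stdGaussian_eq] at this ⊢
    exact this
  have hdist := norm_gradient_sub_integral_sq_le hL x hμ
  rw [← hg] at hdist
  rw [stdGaussian_eq]
  set g := gradient (smooth h μ) x
  have hs := (integrable_inner_sq_mul_norm_sq_stdGaussian g).const_mul 4
  have hd' := (integrable_inner_sq_mul_norm_sq_stdGaussian (gradient h x - g)).const_mul 12
  have ht := (integrable_norm_pow_stdGaussian (E := Vec n) 6).const_mul (3 / 2 * (L ^ 2 * μ ^ 2))
  have hle := integral_mono_of_nonneg (.of_forall fun u => by positivity) ((hs.add hd').add ht)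
    (.of_forall fun u => norm_diff_quotient_smul_sq_le hd hL x g u hμ)
  refine hle.trans ?_
  rw [integral_add' (hs.add hd') ht, integral_add' hs hd']
  simp only [integral_const_mul, integral_inner_sq_mul_norm_sq_stdGaussian,
    integral_norm_pow_six_stdGaussian, finrank_euclideanSpace_fin] at hdist ⊢
  have hn : (0 : ℝ) ≤ n := n.cast_nonneg
  have h1 : (n + 2) * ‖g‖ ^ 2 ≤ (n + 4) * ‖g‖ ^ 2 := by gcongr; norm_num
  have h2 := mul_le_mul_of_nonneg_left hdist (by positivity : (0 : ℝ) ≤ n + 2)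
  have h3 : (L : ℝ) ^ 2 * μ ^ 2 * (12 * ((n + 2) * n) + 3 / 2 * (n * (n + 2) * (n + 4))) ≤
      L ^ 2 * μ ^ 2 * (3 / 2 * (n + 5) ^ 3) := by
    gcongr
    nlinarith
  linarith
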